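/- arXiv:2512.06461 — 7 statements merged into one kernel-verified Lean document; each statement's English description precedes it below -/
import Mathlib

section
/- Let C be a category, M : C ⥤ C a functor, and ψ : M ⟶ 𝟭 C a natural transformation such that every component M(ψ_x) : M(M x) ⟶ M x is an isomorphism. Then for every object y of C such that ψ_y is an isomorphism, and every morphism f : y ⟶ x in C, there exists a unique morphism f' : y ⟶ M x such that f' ≫ ψ_x = f. -/
open CategoryTheory

universe v u

theorem aup {C : Type u} [Category.{v} C] (M : C ⥤ C) (ψ : M ⟶ 𝟭 C)
    (h : ∀ x : C, IsIso (M.map (ψ.app x)))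
    (y : C) (hy : IsIso (ψ.app y)) (x : C) (f : y ⟶ x) :
    ∃! f' : y ⟶ M.obj x, f' ≫ ψ.app x = f := by
  have lift_fac : (inv (ψ.app y) ≫ M.map f) ≫ ψ.app x = f := by simp
  refine ⟨inv (ψ.app y) ≫ M.map f, lift_fac, fun g hg => ?_⟩
  have hx := h x
  have hmap : M.map g = M.map (inv (ψ.app y) ≫ M.map f) :=
    (cancel_mono (M.map (ψ.app x))).1 <|
      (M.map_comp _ _).symm.trans <|
        (congrArg M.map (hg.trans lift_fac.symm)).trans (M.map_comp _ _)
  have hcomp : ψ.app y ≫ g = ψ.app y ≫ inv (ψ.app y) ≫ M.map f :=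
    (ψ.naturality g).symm.trans <|
      (congrArg (· ≫ ψ.app (M.obj x)) hmap).trans (ψ.naturality _)
  exact (cancel_epi (ψ.app y)).1 hcomp
end

section
/- Let C be a category, M : C ⥤ C a functor, and ψ : M ⟶ 𝟭 C a natural transformation such that the component ψ_x is a monomorphism for every object x of C. Then ψ_{M x} = M(ψ_x) for every object x of C, i.e., the natural transformations ψM and Mψ from M ⋙ M to M coincide. -/
open CategoryTheory

universe v u

theorem psiM_eq_Mpsi_of_mono {C : Type u} [Category.{v} C] (M : C ⥤ C) (ψ : M ⟶ 𝟭 C)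
    (h : ∀ x : C, Mono (ψ.app x)) (x : C) :
    ψ.app (M.obj x) = M.map (ψ.app x) := by
  have := h x
  exact (cancel_mono (ψ.app x)).1 (ψ.naturality (ψ.app x)).symm
end

section
/- Let C be a category, M : C ⥤ C a functor, and ψ : M ⟶ 𝟭 C a natural transformation such that (M, ψ) is an idempotent semicomonad, i.e., every component M(ψ_x) and every component ψ_{M x} is an isomorphism. Then (M, ψ) is an idempotent comonad; in particular M(ψ_x) = ψ_{M x} for every object x of C. -/
open CategoryTheory

universe v u

theorem semicomonad_is_comonad {C : Type u} [Category.{v} C]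
    (M : C ⥤ C) (ψ : M ⟶ 𝟭 C)
    (h1 : ∀ x : C, IsIso (M.map (ψ.app x)))
    (h2 : ∀ x : C, IsIso (ψ.app (M.obj x))) :
    (∀ x : C, M.map (ψ.app x) = ψ.app (M.obj x)) ∧
      (∀ x : C, IsIso (M.map (ψ.app x))) := by
  refine ⟨fun x ↦ ?_, h1⟩
  have counit_eq : M.map (ψ.app x) ≫ ψ.app x = ψ.app (M.obj x) ≫ ψ.app x :=
    ψ.naturality (ψ.app x)
  have map_eq : M.map (M.map (ψ.app x)) = M.map (ψ.app (M.obj x)) := by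
    rw [← cancel_mono (M.map (ψ.app x)), ← M.map_comp, ← M.map_comp]
    exact congrArg M.map counit_eq
  have nat_map : M.map (M.map (ψ.app x)) ≫ ψ.app (M.obj x) =
      ψ.app (M.obj (M.obj x)) ≫ M.map (ψ.app x) :=
    ψ.naturality (M.map (ψ.app x))
  have nat_app : M.map (ψ.app (M.obj x)) ≫ ψ.app (M.obj x) =
      ψ.app (M.obj (M.obj x)) ≫ ψ.app (M.obj x) :=
    ψ.naturality (ψ.app (M.obj x))
  have key : ψ.app (M.obj (M.obj x)) ≫ M.map (ψ.app x) =
      ψ.app (M.obj (M.obj x)) ≫ ψ.app (M.obj x) := by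
    rw [← nat_map, ← nat_app, map_eq]
  exact (cancel_epi (ψ.app (M.obj (M.obj x)))).1 key
end

section
/- Let C be a category, M : C ⥤ C a functor, and ψ : M ⟶ 𝟭 C a natural transformation such that (M, ψ) is an idempotent comonad, i.e., Mψ = ψM and every component M(ψ_x) is an isomorphism. Then for every object x of C, the component ψ_x : M x ⟶ x is an isomorphism if and only if x is isomorphic to M x in C. -/
open CategoryTheory

universe v u

theorem coalgebraic_iff_iso {C : Type u} [Category.{v} C]
    (M : C ⥤ C) (ψ : M ⟶ 𝟭 C)
    (heq : ∀ x : C, M.map (ψ.app x) = ψ.app (M.obj x))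
    (hiso : ∀ x : C, IsIso (M.map (ψ.app x))) (x : C) :
    IsIso (ψ.app x) ↔ Nonempty (x ≅ M.obj x) := by
  constructor
  · intro h
    exact ⟨(asIso (ψ.app x)).symm⟩
  · rintro ⟨e⟩
    have : IsIso (ψ.app (M.obj x)) := heq x ▸ hiso x
    have h : ψ.app x = M.map e.hom ≫ ψ.app (M.obj x) ≫ e.inv := by
      simp [← Category.assoc, Iso.eq_comp_inv]
    rw [h]
    infer_instance
end

section
/- Let C be a category, N : C ⥤ C a functor, and η : 𝟭 C ⟶ N a natural transformation such that (N, η) is an idempotent semimonad, i.e., every component N(η_x) and every component η_{N x} is an isomorphism. Then (N, η) is an idempotent monad; in particular N(η_x) = η_{N x} for every object x of C. -/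
open CategoryTheory

universe v u

/-- If `N.map (η.app x)` is an isomorphism and `η.app y` is a monomorphism, then morphisms
`N.obj x ⟶ y` are determined by their precomposition with `η.app x`. -/
theorem eq_of_unit_comp_eq {C : Type u} [Category.{v} C] {N : C ⥤ C} (η : 𝟭 C ⟶ N)
    {x y : C} [IsIso (N.map (η.app x))] [Mono (η.app y)] {f g : N.obj x ⟶ y}
    (h : η.app x ≫ f = η.app x ≫ g) : f = g := by
  have hN : N.map f = N.map g := by
    rw [← cancel_epi (N.map (η.app x)), ← N.map_comp, ← N.map_comp]
    exact congrArg N.map h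
  have hf : f ≫ η.app y = η.app (N.obj x) ≫ N.map f := η.naturality f
  have hg : g ≫ η.app y = η.app (N.obj x) ≫ N.map g := η.naturality g
  exact (cancel_mono (η.app y)).1 (by rw [hf, hg, hN])

theorem semimonad_is_monad {C : Type u} [Category.{v} C]
    (N : C ⥤ C) (η : 𝟭 C ⟶ N)
    (h1 : ∀ x : C, IsIso (N.map (η.app x)))
    (h2 : ∀ x : C, IsIso (η.app (N.obj x))) :
    (∀ x : C, N.map (η.app x) = η.app (N.obj x)) ∧
      (∀ x : C, IsIso (N.map (η.app x))) :=
  ⟨fun x => eq_of_unit_comp_eq η (η.naturality (η.app x)).symm, h1⟩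
end

section
/- Let C be a category, N : C ⥤ C a functor, and η : 𝟭 C ⟶ N a natural transformation such that (N, η) is an idempotent monad, i.e., Nη = ηN and every component N(η_x) is an isomorphism. Then for every object x of C, the component η_x : x ⟶ N x is an isomorphism if and only if x is isomorphic to N x in C. -/
open CategoryTheory

universe v u

theorem algebraic_iff_iso {C : Type u} [Category.{v} C]
    (N : C ⥤ C) (η : 𝟭 C ⟶ N)
    (heq : ∀ x : C, N.map (η.app x) = η.app (N.obj x))
    (hiso : ∀ x : C, IsIso (N.map (η.app x))) (x : C) :
    IsIso (η.app x) ↔ Nonempty (x ≅ N.obj x) := by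
  refine ⟨fun _ => ⟨asIso (η.app x)⟩, fun ⟨e⟩ => ?_⟩
  have hN : IsIso (η.app (N.obj x)) := heq x ▸ hiso x
  have hη : η.app x = e.hom ≫ η.app (N.obj x) ≫ inv (N.map e.hom) := by
    rw [← Category.assoc, IsIso.eq_comp_inv]
    exact (η.naturality e.hom).symm
  rw [hη]
  infer_instance
end

section
/- Let C be a category, M, N : C ⥤ C functors, ψ : M ⟶ 𝟭 C and η : 𝟭 C ⟶ N natural transformations such that (M, ψ) is an idempotent semicomonad and (N, η) is an idempotent semimonad. Assume moreover that every component M(η_x) : M x ⟶ M(N x) and every component N(ψ_x) : N(M x) ⟶ N x is an isomorphism. Then for every morphism f in C, M(f) is an isomorphism if and only if N(f) is an isomorphism. -/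
open CategoryTheory

universe v u

theorem associated_pair {C : Type u} [Category.{v} C]
    (M N : C ⥤ C) (ψ : M ⟶ 𝟭 C) (η : 𝟭 C ⟶ N)
    (hMψ : ∀ x : C, IsIso (M.map (ψ.app x)))
    (hψM : ∀ x : C, IsIso (ψ.app (M.obj x)))
    (hNη : ∀ x : C, IsIso (N.map (η.app x)))
    (hηN : ∀ x : C, IsIso (η.app (N.obj x)))
    (hMη : ∀ x : C, IsIso (M.map (η.app x)))
    (hNψ : ∀ x : C, IsIso (N.map (ψ.app x))) :
    ∀ {x y : C} (f : x ⟶ y), IsIso (M.map f) ↔ IsIso (N.map f) := by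
  intro x y f
  constructor
  · intro _
    have h : N.map f = inv (N.map (ψ.app x)) ≫ N.map (M.map f) ≫ N.map (ψ.app y) := by
      rw [IsIso.eq_inv_comp, ← N.map_comp, ← N.map_comp, ψ.naturality, Functor.id_map]
    rw [h]
    infer_instance
  · intro _
    have h : M.map f = M.map (η.app x) ≫ M.map (N.map f) ≫ inv (M.map (η.app y)) := by
      rw [← Category.assoc, IsIso.eq_comp_inv, ← M.map_comp, ← M.map_comp, ← η.naturality,
        Functor.id_map]
    rw [h]
    infer_instance
end
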